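/- arXiv:2605.27581 — 2 statements merged into one kernel-verified Lean document; each statement's English description precedes it below -/
import Mathlib

section
/- Let H be a Banach space and let (T(t))_{t≥0} be a family of bounded linear operators on H with T(0) = I, ‖T(t)‖ ≤ M e^{−ωt} for all t ≥ 0 (M ≥ 1, ω > 0), and t ↦ T(t)x continuous for every x ∈ H. Let B : H → H be a bounded linear operator such that for every x ∈ H the map τ ↦ B(T(τ)x) is differentiable on [0,∞) with derivative T(τ)x. Let U₀ ∈ H, let F : H → H, and let U be a mild solution with initial datum U₀ such that the function τ ↦ F(U(τ)) satisfies ‖F(U(τ))‖ ≤ C_F for all τ ≥ 0 and ‖F(U(τ)) − F(U(σ))‖ ≤ K̃ |τ − σ| for all τ, σ ≥ 0. Then for all 0 ≤ s ≤ t, ‖B(U(t)) − B(U(s))‖ ≤ (M‖U₀‖ + ‖B‖·(M K̃/ω + M C_F)) · (t − s). -/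
theorem aux_contOn {H : Type*} [NormedAddCommGroup H] [NormedSpace ℝ H]
    (T : ℝ → H →L[ℝ] H) (M : ℝ) (S : Set ℝ)
    (hb : ∀ t ∈ S, ‖T t‖ ≤ M)
    (hc : ∀ x : H, ContinuousOn (fun t => T t x) S)
    (g : ℝ → H) (hg : ContinuousOn g S) : ContinuousOn (fun r => T r (g r)) S := by
  intro r hr
  have h1 : Filter.Tendsto (fun q => T q (g q - g r)) (nhdsWithin r S) (nhds 0) := by
    have h2 : Filter.Tendsto (fun q => M * ‖g q - g r‖) (nhdsWithin r S) (nhds 0) := by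
      have h3 : Filter.Tendsto (fun q => g q - g r) (nhdsWithin r S) (nhds (g r - g r)) :=
        (hg r hr).sub tendsto_const_nhds
      simpa using h3.norm.const_mul M
    refine squeeze_zero_norm' ?_ h2
    filter_upwards [self_mem_nhdsWithin] with q hq
    exact (T q).le_of_opNorm_le (hb q hq) _
  have h4 := h1.add (hc (g r) r hr)
  simpa [ContinuousWithinAt] using h4

/-- Lipschitz-in-time estimate in the extrapolation space: if
`B` plays the role of the bounded inverse of the generator (so that
`d/dτ (B T(τ)x) = T(τ)x`), and along the mild solution `U` the forcing
`τ ↦ F(U(τ))` is bounded by `C_F` and `Ktilde`-Lipschitz in time, then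
`‖B(U(t)) − B(U(s))‖ ≤ (M‖U₀‖ + ‖B‖(MKtilde/ω + MC_F))(t − s)` for `0 ≤ s ≤ t`. -/
theorem extrapolation_lipschitz_in_time
    {H : Type*} [NormedAddCommGroup H] [NormedSpace ℝ H] [CompleteSpace H]
    (T : ℝ → H →L[ℝ] H)
    (hT0 : T 0 = ContinuousLinearMap.id ℝ H)
    (M ω : ℝ) (hM : 1 ≤ M) (hω : 0 < ω)
    (hTdecay : ∀ t, 0 ≤ t → ‖T t‖ ≤ M * Real.exp (-ω * t))
    (hTcont : ∀ x : H, ContinuousOn (fun t => T t x) (Set.Ici 0))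
    (B : H →L[ℝ] H)
    (hB : ∀ (x : H) (τ : ℝ), 0 ≤ τ →
      HasDerivAt (fun σ => B (T σ x)) (T τ x) τ)
    (U₀ : H) (F : H → H) (U : ℝ → H)
    (hUcont : ContinuousOn U (Set.Ici 0))
    (hU : ∀ t, 0 ≤ t →
      U t = T t U₀ + ∫ s in (0 : ℝ)..t, T (t - s) (F (U s)))
    (C_F Ktilde : ℝ)
    (hFbdd : ∀ τ, 0 ≤ τ → ‖F (U τ)‖ ≤ C_F)
    (hFlip : ∀ τ σ, 0 ≤ τ → 0 ≤ σ → ‖F (U τ) - F (U σ)‖ ≤ Ktilde * |τ - σ|) :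
    ∀ s t : ℝ, 0 ≤ s → s ≤ t →
      ‖B (U t) - B (U s)‖
        ≤ (M * ‖U₀‖ + ‖B‖ * (M * Ktilde / ω + M * C_F)) * (t - s) := by
  intro s t hs hst
  have ht : 0 ≤ t := hs.trans hst
  have hM0 : 0 ≤ M := by linarith
  have hTM : ∀ r, 0 ≤ r → ‖T r‖ ≤ M := fun r hr => (hTdecay r hr).trans (by
    have : Real.exp (-ω * r) ≤ 1 := Real.exp_le_one_iff.mpr (by nlinarith)
    nlinarith)
  have hK : 0 ≤ Ktilde := by
    have := (norm_nonneg _).trans (hFlip 1 0 (by norm_num) le_rfl)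
    simpa using this
  have hfc : ContinuousOn (fun r => F (U r)) (Set.Ici 0) := by
    have : LipschitzOnWith ⟨Ktilde, hK⟩ (fun r => F (U r)) (Set.Ici 0) := by
      refine LipschitzOnWith.of_dist_le_mul fun x hx y hy => ?_
      rw [dist_eq_norm, Real.dist_eq]
      exact hFlip x y hx hy
    exact this.continuousOn
  have hcont : ∀ a, ContinuousOn (fun r => T r (F (U (a - r)))) (Set.Icc 0 a) := by
    intro a
    refine aux_contOn T M _ (fun r hr => hTM r hr.1)
      (fun x => (hTcont x).mono fun r hr => hr.1) (fun r => F (U (a - r))) ?_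
    refine hfc.comp (f := fun r => a - r) (by fun_prop) fun r hr => ?_
    simpa using hr.2
  have hint : ∀ a b c, 0 ≤ b → b ≤ c → c ≤ a → IntervalIntegrable
      (fun r => T r (F (U (a - r)))) MeasureTheory.volume b c := by
    intro a b c hb hbc hca
    refine ContinuousOn.intervalIntegrable_of_Icc hbc ?_
    exact (hcont a).mono (Set.Icc_subset_Icc hb hca)
  have hV : ∀ a, ∫ r in (0:ℝ)..a, T (a - r) (F (U r)) = ∫ r in (0:ℝ)..a, T r (F (U (a - r))) := by
    intro a
    have := intervalIntegral.integral_comp_sub_left (a := 0) (b := a)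
      (fun r => T r (F (U (a - r)))) a
    simpa using this
  have hsplit : (∫ r in (0:ℝ)..t, T r (F (U (t - r)))) - ∫ r in (0:ℝ)..s, T r (F (U (s - r)))
      = (∫ r in (0:ℝ)..s, (T r (F (U (t - r))) - T r (F (U (s - r)))))
        + ∫ r in s..t, T r (F (U (t - r))) := by
    rw [intervalIntegral.integral_sub (hint t 0 s le_rfl hs hst) (hint s 0 s le_rfl hs le_rfl),
      ← intervalIntegral.integral_add_adjacent_intervals (hint t 0 s le_rfl hs hst)
        (hint t s t hs hst le_rfl)]
    abel
  have hI2 : ‖∫ r in s..t, T r (F (U (t - r)))‖ ≤ M * C_F * (t - s) := by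
    have := intervalIntegral.norm_integral_le_of_norm_le_const (a := s) (b := t)
      (f := fun r => T r (F (U (t - r)))) (C := M * C_F) (fun r hr => by
        rw [Set.uIoc_of_le hst] at hr
        exact (T r).le_of_opNorm_le_of_le (hTM r (hs.trans hr.1.le))
          (hFbdd _ (by linarith [hr.2])))
    rwa [abs_of_nonneg (by linarith)] at this
  have hI1 : ‖∫ r in (0:ℝ)..s, (T r (F (U (t - r))) - T r (F (U (s - r))))‖
      ≤ M * Ktilde / ω * (t - s) := by
    have h1 := intervalIntegral.norm_integral_le_of_norm_le (μ := MeasureTheory.volume) (a := 0) (b := s)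
      (f := fun r => T r (F (U (t - r))) - T r (F (U (s - r))))
      (g := fun r => M * Real.exp (-ω * r) * (Ktilde * (t - s))) hs
      (Filter.Eventually.of_forall fun r hr => by
        rw [← map_sub]
        refine (T r).le_of_opNorm_le_of_le (hTdecay r hr.1.le) ?_
        have := hFlip (t - r) (s - r) (by linarith [hr.2]) (by linarith [hr.2])
        rwa [show t - r - (s - r) = t - s by ring, abs_of_nonneg (by linarith)] at this)
      (Continuous.intervalIntegrable (by fun_prop) _ _)
    have h2 : ∫ r in (0:ℝ)..s, M * Real.exp (-ω * r) * (Ktilde * (t - s))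
        = -(M * Ktilde / ω * (t - s)) * Real.exp (-ω * s)
          - -(M * Ktilde / ω * (t - s)) * Real.exp (-ω * 0) := by
      refine intervalIntegral.integral_eq_sub_of_hasDerivAt
        (f := fun r => -(M * Ktilde / ω * (t - s)) * Real.exp (-ω * r)) (fun r _ => ?_)
        (Continuous.intervalIntegrable (by fun_prop) _ _)
      have h3 : HasDerivAt (fun r : ℝ => -ω * r) (-ω) r := by
        simpa using (hasDerivAt_id r).const_mul (-ω)
      refine (h3.exp.const_mul (-(M * Ktilde / ω * (t - s)))).congr_deriv ?_
      have hω' : ω ≠ 0 := hω.ne'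
      field_simp
    rw [h2] at h1
    refine h1.trans ?_
    have : 0 ≤ M * Ktilde / ω * (t - s) * Real.exp (-ω * s) := by
      have : 0 ≤ t - s := by linarith
      positivity
    simp only [mul_zero, Real.exp_zero]
    linarith
  have hA : ‖B (T t U₀) - B (T s U₀)‖ ≤ M * ‖U₀‖ * (t - s) := by
    refine norm_image_sub_le_of_norm_deriv_le_segment' (f := fun σ => B (T σ U₀))
      (f' := fun σ => T σ U₀) (a := s) (b := t) (fun x hx => ?_) (fun x hx => ?_) t ⟨hst, le_rfl⟩
    · exact (hB U₀ x (hs.trans hx.1)).hasDerivWithinAt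
    · exact (T x).le_of_opNorm_le (hTM x (hs.trans hx.1)) _
  have heq : B (U t) - B (U s) = (B (T t U₀) - B (T s U₀))
      + B ((∫ r in (0:ℝ)..s, (T r (F (U (t - r))) - T r (F (U (s - r)))))
        + ∫ r in s..t, T r (F (U (t - r)))) := by
    rw [← hsplit, hU t ht, hU s hs, hV t, hV s]
    simp only [map_add, map_sub]
    abel
  rw [heq]
  calc _ ≤ M * ‖U₀‖ * (t - s) + ‖B‖ * (M * Ktilde / ω * (t - s) + M * C_F * (t - s)) :=
        norm_add_le_of_le hA (B.le_opNorm_of_le (norm_add_le_of_le hI1 hI2))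
    _ = _ := by ring
end

section
/- For integers m, n ≥ 1 set N = 2m + 2n; let h(s) = 1 − 10s³ + 15s⁴ − 6s⁵; for R > 0 define φ_R : [0,∞) → ℝ by φ_R(r) = 1 for 0 ≤ r ≤ R, φ_R(r) = h((r−R)/R) + (1 − h((r−R)/R))·(R/r)^{N−1} for R < r < 2R, and φ_R(r) = (R/r)^{N−1} for r ≥ 2R. Define the truncated potential p_R : ℝ² → ℝ by p_R(x,y) = φ_R(√(x²+y²)) · x^{2m} y^{2n}. Then p_R is twice continuously differentiable on ℝ², its gradient ∇p_R agrees with ∇p, where p(x,y) = x^{2m}y^{2n}, on the closed ball of radius R centered at the origin, and there exists a constant C_R > 0 such that |∇p_R(X) − ∇p_R(Y)| ≤ C_R |X − Y| for all X, Y ∈ ℝ²; that is, ∇p_R is globally Lipschitz on ℝ². -/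
/-- The quintic Hermite transition polynomial `h(s) = 1 − 10s³ + 15s⁴ − 6s⁵`. -/
noncomputable def hermiteQuintic (s : ℝ) : ℝ :=
  1 - 10 * s ^ 3 + 15 * s ^ 4 - 6 * s ^ 5

/-- The radial cutoff weight `φ_R`: equal to `1` for `r ≤ R`, a Hermite
interpolation on `(R, 2R)`, and the power decay `(R/r)^{N−1}` for `r ≥ 2R`. -/
noncomputable def radialCutoff (N : ℕ) (R r : ℝ) : ℝ :=
  if r ≤ R then 1
  else if r < 2 * R then
    hermiteQuintic ((r - R) / R)
      + (1 - hermiteQuintic ((r - R) / R)) * (R / r) ^ (N - 1)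
  else (R / r) ^ (N - 1)

/-- The truncated potential `p_R(x,y) = φ_R(√(x²+y²)) x^{2m} y^{2n}`. -/
noncomputable def truncatedPotential (m n N : ℕ) (R : ℝ) (v : ℝ × ℝ) : ℝ :=
  radialCutoff N R (Real.sqrt (v.1 ^ 2 + v.2 ^ 2)) * v.1 ^ (2 * m) * v.2 ^ (2 * n)

lemma norm_smul_clm {E F : Type*} [NormedAddCommGroup E] [NormedSpace ℝ E]
    [NormedAddCommGroup F] [NormedSpace ℝ F] (c : ℝ) (A : E →L[ℝ] F) : ‖c • A‖ = ‖c‖ * ‖A‖ :=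
  norm_smul c A

lemma hasDerivAt_posPow (k : ℕ) (s : ℝ) :
    HasDerivAt (fun s : ℝ => max s 0 ^ (k + 2)) ((k + 2 : ℝ) * max s 0 ^ (k + 1)) s := by
  rcases lt_trichotomy s 0 with h | h | h
  · have h0 : max s 0 = 0 := max_eq_right h.le
    have : (fun s : ℝ => max s 0 ^ (k + 2)) =ᶠ[nhds s] fun _ => 0 := by
      filter_upwards [gt_mem_nhds h] with t ht
      simp [max_eq_right ht.le]
    rw [h0]
    simpa using (hasDerivAt_const s (0 : ℝ)).congr_of_eventuallyEq this
  · subst h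
    have h2 : HasDerivAt (fun s : ℝ => s ^ (k + 2)) 0 0 := by
      simpa using hasDerivAt_pow (k + 2) (0 : ℝ)
    rw [hasDerivAt_iff_isLittleO] at h2 ⊢
    simp only [max_self, ne_eq, Nat.add_eq_zero_iff, one_ne_zero, and_false, not_false_eq_true,
      zero_pow, mul_zero, smul_zero, sub_zero, OfNat.ofNat_ne_zero] at h2 ⊢
    refine Asymptotics.IsBigO.trans_isLittleO ?_ h2
    refine Asymptotics.IsBigO.of_bound 1 (Filter.Eventually.of_forall fun t => ?_)
    rw [one_mul, norm_pow, norm_pow]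
    gcongr
    rw [Real.norm_eq_abs, Real.norm_eq_abs, abs_of_nonneg (le_max_right _ _)]
    exact max_le (le_abs_self t) (abs_nonneg t)
  · have h0 : max s 0 = s := max_eq_left h.le
    have : (fun s : ℝ => max s 0 ^ (k + 2)) =ᶠ[nhds s] fun s => s ^ (k + 2) := by
      filter_upwards [lt_mem_nhds h] with t ht
      simp [max_eq_left ht.le]
    rw [h0]
    have h3 := (hasDerivAt_pow (k + 2) s).congr_of_eventuallyEq this
    simpa using h3

lemma contDiff_posPow_one : ContDiff ℝ 1 (fun s : ℝ => max s 0 ^ 2) := by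
  rw [contDiff_one_iff_deriv]
  refine ⟨fun s => (hasDerivAt_posPow 0 s).differentiableAt, ?_⟩
  have : deriv (fun s : ℝ => max s 0 ^ 2) = fun s => (((0 : ℕ) : ℝ) + 2) * max s 0 ^ (0 + 1) :=
    funext fun s => (hasDerivAt_posPow 0 s).deriv
  rw [this]
  fun_prop

lemma contDiff_posPow_two : ContDiff ℝ 2 (fun s : ℝ => max s 0 ^ 3) := by
  have h2 : (2 : WithTop ℕ∞) = 1 + 1 := by norm_num
  rw [h2, contDiff_succ_iff_deriv]
  refine ⟨fun s => (hasDerivAt_posPow 1 s).differentiableAt, by simp, ?_⟩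
  have : deriv (fun s : ℝ => max s 0 ^ 3) = fun s => (((1 : ℕ) : ℝ) + 2) * max s 0 ^ (1 + 1) :=
    funext fun s => (hasDerivAt_posPow 1 s).deriv
  rw [this]
  exact contDiff_const.mul contDiff_posPow_one

/-- The clamped transition, written as a globally C² function. -/
noncomputable def clampQ (s : ℝ) : ℝ :=
  max s 0 ^ 3 * (10 - 15 * s + 6 * s ^ 2)
    - max (s - 1) 0 ^ 3 * (10 + 15 * (s - 1) + 6 * (s - 1) ^ 2)

lemma contDiff_clampQ : ContDiff ℝ 2 clampQ := by
  unfold clampQ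
  have h1 : ContDiff ℝ 2 (fun s : ℝ => max (s - 1) 0 ^ 3) :=
    contDiff_posPow_two.comp (contDiff_id.sub contDiff_const)
  have h2 : ContDiff ℝ 2 (fun s : ℝ => (10 - 15 * s + 6 * s ^ 2)) := by fun_prop
  have h3 : ContDiff ℝ 2 (fun s : ℝ => (10 + 15 * (s - 1) + 6 * (s - 1) ^ 2)) := by fun_prop
  exact (contDiff_posPow_two.mul h2).sub (h1.mul h3)

lemma radialCutoff_eq (N : ℕ) (R r : ℝ) (hR : 0 < R) :
    radialCutoff N R r = 1 + clampQ ((r - R) / R) * ((R / r) ^ (N - 1) - 1) := by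
  unfold radialCutoff clampQ hermiteQuintic
  split_ifs with h1 h2
  · have : (r - R) / R ≤ 0 := div_nonpos_of_nonpos_of_nonneg (by linarith) hR.le
    rw [max_eq_right this, max_eq_right (by linarith)]
    ring
  · have a : 0 ≤ (r - R) / R := div_nonneg (by linarith) hR.le
    have b : (r - R) / R ≤ 1 := by rw [div_le_one hR]; linarith
    rw [max_eq_left a, max_eq_right (by linarith)]
    ring
  · have b : 1 ≤ (r - R) / R := by rw [le_div_iff₀ hR]; linarith
    rw [max_eq_left (by linarith), max_eq_left (by linarith)]
    ring

lemma contDiff_mono (m n : ℕ) :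
    ContDiff ℝ 2 (fun w : ℝ × ℝ => w.1 ^ (2 * m) * w.2 ^ (2 * n)) := by fun_prop

lemma truncated_inner (m n N : ℕ) (R : ℝ) (v : ℝ × ℝ)
    (hv : Real.sqrt (v.1 ^ 2 + v.2 ^ 2) < R) :
    truncatedPotential m n N R =ᶠ[nhds v] fun w : ℝ × ℝ => w.1 ^ (2 * m) * w.2 ^ (2 * n) := by
  have hc : Continuous fun v : ℝ × ℝ => Real.sqrt (v.1 ^ 2 + v.2 ^ 2) := by fun_prop
  filter_upwards [hc.continuousAt.eventually (gt_mem_nhds hv)] with w hw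
  simp [truncatedPotential, radialCutoff, hw.le]

lemma truncated_contDiff (m n N : ℕ) (R : ℝ) (hR : 0 < R) :
    ContDiff ℝ 2 (truncatedPotential m n N R) := by
  rw [contDiff_iff_contDiffAt]
  intro v
  by_cases hv : Real.sqrt (v.1 ^ 2 + v.2 ^ 2) < R
  · exact (contDiff_mono m n).contDiffAt.congr_of_eventuallyEq (truncated_inner m n N R v hv)
  · have hpos : 0 < Real.sqrt (v.1 ^ 2 + v.2 ^ 2) := by linarith
    have hpos' : v.1 ^ 2 + v.2 ^ 2 ≠ 0 := (Real.sqrt_pos.1 hpos).ne'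
    have hs : ContDiffAt ℝ 2 (fun v : ℝ × ℝ => Real.sqrt (v.1 ^ 2 + v.2 ^ 2)) v :=
      ContDiffAt.sqrt (by fun_prop) hpos'
    have he : truncatedPotential m n N R = fun v : ℝ × ℝ =>
        (1 + clampQ ((Real.sqrt (v.1 ^ 2 + v.2 ^ 2) - R) / R) *
          ((R / Real.sqrt (v.1 ^ 2 + v.2 ^ 2)) ^ (N - 1) - 1)) *
          (v.1 ^ (2 * m) * v.2 ^ (2 * n)) := by
      funext v
      rw [truncatedPotential, radialCutoff_eq N R _ hR, mul_assoc]
    rw [he]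
    refine ContDiffAt.mul ?_ (contDiff_mono m n).contDiffAt
    refine contDiffAt_const.add (ContDiffAt.mul ?_ ?_)
    · exact contDiff_clampQ.contDiffAt.comp v ((hs.sub contDiffAt_const).div_const R)
    · exact ((contDiffAt_const.div hs hpos.ne').pow _).sub contDiffAt_const

lemma sqrt_homog (c : ℝ) (hc : 0 ≤ c) (u : ℝ × ℝ) :
    Real.sqrt ((c • u).1 ^ 2 + (c • u).2 ^ 2) = c * Real.sqrt (u.1 ^ 2 + u.2 ^ 2) := by
  have : (c • u).1 ^ 2 + (c • u).2 ^ 2 = c ^ 2 * (u.1 ^ 2 + u.2 ^ 2) := by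
    simp; ring
  rw [this, Real.sqrt_mul (sq_nonneg c), Real.sqrt_sq hc]

lemma norm_le_sqrt (u : ℝ × ℝ) : ‖u‖ ≤ Real.sqrt (u.1 ^ 2 + u.2 ^ 2) := by
  rw [Prod.norm_def]
  refine max_le ?_ ?_ <;> rw [Real.norm_eq_abs] <;> apply Real.abs_le_sqrt <;> nlinarith [sq_nonneg u.1, sq_nonneg u.2]

lemma truncated_homog (m n N : ℕ) (hm : 1 ≤ m) (hN : N = 2 * m + 2 * n) (R : ℝ) (hR : 0 < R)
    (c : ℝ) (hc : 1 ≤ c) (u : ℝ × ℝ) (hu : 2 * R < ‖u‖) :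
    truncatedPotential m n N R (c • u) = c * truncatedPotential m n N R u := by
  have h1 := norm_le_sqrt u
  have hc0 : 0 < c := by linarith
  unfold truncatedPotential
  rw [sqrt_homog c hc0.le]
  set r := Real.sqrt (u.1 ^ 2 + u.2 ^ 2)
  have h2 : r ≤ c * r := by nlinarith
  unfold radialCutoff
  rw [if_neg (by linarith), if_neg (by linarith), if_neg (by linarith), if_neg (by linarith)]
  obtain ⟨k, rfl⟩ : ∃ k, N = k + 1 := ⟨N - 1, by omega⟩
  have e : c ^ (2 * m) * c ^ (2 * n) = c ^ k * c := by rw [← pow_add, ← hN, pow_succ]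
  have hk : (R / (c * r)) ^ k * c ^ k = (R / r) ^ k := by
    rw [← mul_pow]; congr 1
    have : r ≠ 0 := by linarith
    field_simp
  simp only [Prod.smul_fst, Prod.smul_snd, smul_eq_mul, mul_pow, Nat.add_sub_cancel]
  calc _ = (R / (c * r)) ^ k * (c ^ (2 * m) * c ^ (2 * n)) * u.1 ^ (2 * m) * u.2 ^ (2 * n) := by ring
    _ = ((R / (c * r)) ^ k * c ^ k) * c * u.1 ^ (2 * m) * u.2 ^ (2 * n) := by rw [e]; ring
    _ = _ := by rw [hk]; ring

lemma hessian_bound (f : ℝ × ℝ → ℝ) (hf : ContDiff ℝ 2 f) (R : ℝ) (hR : 0 < R)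
    (hom : ∀ c : ℝ, 1 ≤ c → ∀ u : ℝ × ℝ, 2 * R < ‖u‖ → f (c • u) = c * f u) :
    ∃ C : ℝ, 0 < C ∧ ∀ v, ‖fderiv ℝ (fderiv ℝ f) v‖ ≤ C := by
  have h1 : ContDiff ℝ 1 (fderiv ℝ f) := hf.fderiv_right (by norm_num)
  have h2 : Continuous (fderiv ℝ (fderiv ℝ f)) := h1.continuous_fderiv (by norm_num)
  obtain ⟨C, hC⟩ := (isCompact_closedBall (0 : ℝ × ℝ) (3 * R)).exists_bound_of_continuousOn (f := fderiv ℝ (fderiv ℝ f))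
    h2.continuousOn
  refine ⟨max C 1, by positivity, fun v => ?_⟩
  by_cases hv : ‖v‖ ≤ 3 * R
  · exact (hC v (by simpa using hv)).trans (le_max_left _ _)
  push Not at hv
  set c := ‖v‖ / (3 * R) with hcdef
  have hc : 1 ≤ c := by rw [hcdef, le_div_iff₀ (by positivity)]; linarith
  have hc0 : 0 < c := by linarith
  set w := c⁻¹ • v with hw
  have hvw : c • w = v := smul_inv_smul₀ hc0.ne' v
  have hwn : ‖w‖ = 3 * R := by
    rw [hw, norm_smul, norm_inv, Real.norm_of_nonneg hc0.le, hcdef]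
    have : ‖v‖ ≠ 0 := by linarith
    field_simp
  have hopen : ∀ u : ℝ × ℝ, 2 * R < ‖u‖ → ∀ᶠ x in nhds u, 2 * R < ‖x‖ := fun u hu =>
    continuous_norm.continuousAt.eventually (lt_mem_nhds hu)
  have g1 : ∀ u : ℝ × ℝ, 2 * R < ‖u‖ → fderiv ℝ f (c • u) = fderiv ℝ f u := by
    intro u hu
    have he : (fun x => f (c • x)) =ᶠ[nhds u] fun x => c • f x := by
      filter_upwards [hopen u hu] with x hx
      exact hom c hc x hx
    have h := he.fderiv_eq (𝕜 := ℝ)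
    rw [fderiv_comp_smul, fderiv_fun_const_smul (hf.differentiable (by norm_num) u)] at h
    exact smul_right_injective _ hc0.ne' h
  have he : (fun x => fderiv ℝ f (c • x)) =ᶠ[nhds w] fderiv ℝ f := by
    filter_upwards [hopen w (by linarith)] with x hx
    exact g1 x hx
  have h := he.fderiv_eq (𝕜 := ℝ)
  rw [fderiv_comp_smul, hvw] at h
  have hb := hC w (by simp [hwn])
  rw [← h, norm_smul_clm, Real.norm_of_nonneg hc0.le] at hb
  refine le_trans ?_ (le_max_left _ _)
  nlinarith [norm_nonneg (fderiv ℝ (fderiv ℝ f) v)]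

/-- The truncated potential `p_R` is C² on `ℝ²`, its gradient
agrees with that of `p(x,y) = x^{2m}y^{2n}` on the closed ball of radius `R`,
and its gradient is globally Lipschitz on `ℝ²`. -/
theorem truncatedPotential_gradient_globally_lipschitz
    (m n : ℕ) (hm : 1 ≤ m) (hn : 1 ≤ n) (N : ℕ) (hN : N = 2 * m + 2 * n)
    (R : ℝ) (hR : 0 < R) :
    ContDiff ℝ 2 (truncatedPotential m n N R) ∧
    (∀ v : ℝ × ℝ, Real.sqrt (v.1 ^ 2 + v.2 ^ 2) ≤ R →
      fderiv ℝ (truncatedPotential m n N R) v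
        = fderiv ℝ (fun w : ℝ × ℝ => w.1 ^ (2 * m) * w.2 ^ (2 * n)) v) ∧
    ∃ C : ℝ, 0 < C ∧ ∀ X Y : ℝ × ℝ,
      ‖fderiv ℝ (truncatedPotential m n N R) X
        - fderiv ℝ (truncatedPotential m n N R) Y‖ ≤ C * ‖X - Y‖ := by
  have hC2 := truncated_contDiff m n N R hR
  refine ⟨hC2, ?_, ?_⟩
  · intro v hv
    have hcl : IsClosed {t : ℝ | fderiv ℝ (truncatedPotential m n N R) (t • v)
        = fderiv ℝ (fun w : ℝ × ℝ => w.1 ^ (2 * m) * w.2 ^ (2 * n)) (t • v)} := by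
      have c1 := hC2.continuous_fderiv (by norm_num)
      have c2 := (contDiff_mono m n).continuous_fderiv (by norm_num)
      exact isClosed_eq (c1.comp (by fun_prop)) (c2.comp (by fun_prop))
    have hsub : Set.Ico (0 : ℝ) 1 ⊆ {t : ℝ | fderiv ℝ (truncatedPotential m n N R) (t • v)
        = fderiv ℝ (fun w : ℝ × ℝ => w.1 ^ (2 * m) * w.2 ^ (2 * n)) (t • v)} := by
      intro t ht
      refine (truncated_inner m n N R (t • v) ?_).fderiv_eq
      rw [sqrt_homog t ht.1]
      have := ht.2
      have := ht.1
      nlinarith [Real.sqrt_nonneg (v.1 ^ 2 + v.2 ^ 2)]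
    have h := hcl.closure_subset_iff.2 hsub
    rw [closure_Ico (by norm_num)] at h
    have h1 := h (show (1 : ℝ) ∈ Set.Icc 0 1 by simp)
    simpa only [Set.mem_setOf_eq, one_smul] using h1
  · obtain ⟨C, hC0, hC⟩ := hessian_bound _ hC2 R hR
      (fun c hc u hu => truncated_homog m n N hm hN R hR c hc u hu)
    refine ⟨C, hC0, fun X Y => ?_⟩
    have h1 : ContDiff ℝ 1 (fderiv ℝ (truncatedPotential m n N R)) :=
      hC2.fderiv_right (by norm_num)
    exact convex_univ.norm_image_sub_le_of_norm_fderiv_le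
      (fun x _ => h1.differentiable (by norm_num) x) (fun x _ => hC x)
      (Set.mem_univ Y) (Set.mem_univ X)
end
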